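/- Characterization of the ergodic constant: assume f ∈ C(Ω̄) and m > 2, and let c ∈ ℝ be the ergodic constant, i.e. the unique constant for which the state-constraint problem Erg(Ω,f,c) has a viscosity solution that is Hölder continuous on Ω̄ with exponent (m−2)/(m−1) and locally Lipschitz in Ω. Then c = inf{ a ∈ ℝ : there exists u_a ∈ C(Ω̄) which is a viscosity subsolution of −Δu_a + |Du_a|^m ≤ f + a in Ω }. -/

import Mathlib

open Set Filter Topology Metric MeasureTheory

noncomputable section

/-- Euclidean space `ℝ^N`. -/
abbrev Euc (N : ℕ) : Type := EuclideanSpace ℝ (Fin N)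

/-- The Laplacian of `φ` at `x`, computed as the trace of the second derivative
in the standard orthonormal basis of `ℝ^N`. -/
noncomputable def lapl {N : ℕ} (φ : Euc N → ℝ) (x : Euc N) : ℝ :=
  ∑ i : Fin N,
    iteratedFDeriv ℝ 2 φ x ![EuclideanSpace.single i 1, EuclideanSpace.single i 1]

/-- `Ω` is a domain with `C²` boundary: it is the sublevel set of a `C²`
defining function whose gradient does not vanish on the boundary. -/
def HasC2Boundary {N : ℕ} (Ω : Set (Euc N)) : Prop :=
  ∃ ρ : Euc N → ℝ, ContDiff ℝ 2 ρ ∧ Ω = {x | ρ x < 0} ∧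
    frontier Ω = {x | ρ x = 0} ∧ ∀ x ∈ frontier Ω, gradient ρ x ≠ 0

/-- The stationary operator `−Δφ(x) + |Dφ(x)|^m + λ r − h(x)` evaluated with the
value `r` of the (sub/super)solution at `x`. -/
noncomputable def statOp {N : ℕ} (h : Euc N → ℝ) (lam m : ℝ)
    (φ : Euc N → ℝ) (r : ℝ) (x : Euc N) : ℝ :=
  -lapl φ x + ‖gradient φ x‖ ^ m + lam * r - h x

/-- Viscosity subsolution of the generalized Dirichlet problem
`S(Ω,h,k,λ)`: `−Δw + |Dw|^m + λ w = h` in `Ω`, `w = k` on `∂Ω`. -/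
def IsStatSub {N : ℕ} (Ω : Set (Euc N)) (h k : Euc N → ℝ) (lam m : ℝ)
    (u : Euc N → ℝ) : Prop :=
  UpperSemicontinuousOn u (closure Ω) ∧
  ∀ φ : Euc N → ℝ, ContDiff ℝ 2 φ → ∀ x₀ ∈ closure Ω,
    IsLocalMaxOn (u - φ) (closure Ω) x₀ →
      (x₀ ∈ Ω → statOp h lam m φ (u x₀) x₀ ≤ 0) ∧
      (x₀ ∈ frontier Ω → min (statOp h lam m φ (u x₀) x₀) (u x₀ - k x₀) ≤ 0)

/-- Viscosity supersolution of the generalized Dirichlet problem `S(Ω,h,k,λ)`. -/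
def IsStatSuper {N : ℕ} (Ω : Set (Euc N)) (h k : Euc N → ℝ) (lam m : ℝ)
    (v : Euc N → ℝ) : Prop :=
  LowerSemicontinuousOn v (closure Ω) ∧
  ∀ φ : Euc N → ℝ, ContDiff ℝ 2 φ → ∀ x₀ ∈ closure Ω,
    IsLocalMinOn (v - φ) (closure Ω) x₀ →
      (x₀ ∈ Ω → 0 ≤ statOp h lam m φ (v x₀) x₀) ∧
      (x₀ ∈ frontier Ω → 0 ≤ max (statOp h lam m φ (v x₀) x₀) (v x₀ - k x₀))

/-- The parabolic operator
`φ_t(x,t) − Δφ(·,t)(x) + |Dφ(·,t)(x)|^m + λ r − f(x)`. -/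
noncomputable def parOp {N : ℕ} (f : Euc N → ℝ) (lam m : ℝ)
    (φ : Euc N × ℝ → ℝ) (r : ℝ) (x : Euc N) (t : ℝ) : ℝ :=
  deriv (fun s => φ (x, s)) t - lapl (fun y => φ (y, t)) x
    + ‖gradient (fun y => φ (y, t)) x‖ ^ m + lam * r - f x

/-- Viscosity subsolution of the generalized initial-boundary value problem
`E(Ω,f,g,u₀,λ)` on the time interval `[0,T]`:
`u_t − Δu + |Du|^m + λ u = f` in `Ω × (0,T]`, `u = g` on `∂Ω × (0,T]`,
`u(·,0) = u₀` on `closure Ω`. -/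
def IsParSub {N : ℕ} (Ω : Set (Euc N)) (f g u₀ : Euc N → ℝ) (lam m T : ℝ)
    (u : Euc N → ℝ → ℝ) : Prop :=
  UpperSemicontinuousOn (fun p : Euc N × ℝ => u p.1 p.2) (closure Ω ×ˢ Ico 0 T) ∧
  (∀ x ∈ closure Ω, u x 0 ≤ u₀ x) ∧
  ∀ φ : Euc N × ℝ → ℝ, ContDiff ℝ 2 φ → ∀ x₀ : Euc N, ∀ t₀ : ℝ,
    (x₀, t₀) ∈ closure Ω ×ˢ Ioc 0 T →
    IsLocalMaxOn (fun p : Euc N × ℝ => u p.1 p.2 - φ p) (closure Ω ×ˢ Ioc 0 T) (x₀, t₀) →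
      (x₀ ∈ Ω → parOp f lam m φ (u x₀ t₀) x₀ t₀ ≤ 0) ∧
      (x₀ ∈ frontier Ω →
        min (parOp f lam m φ (u x₀ t₀) x₀ t₀) (u x₀ t₀ - g x₀) ≤ 0)

/-- Viscosity supersolution of `E(Ω,f,g,u₀,λ)` on the time interval `[0,T]`. -/
def IsParSuper {N : ℕ} (Ω : Set (Euc N)) (f g u₀ : Euc N → ℝ) (lam m T : ℝ)
    (v : Euc N → ℝ → ℝ) : Prop :=
  LowerSemicontinuousOn (fun p : Euc N × ℝ => v p.1 p.2) (closure Ω ×ˢ Icc 0 T) ∧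
  (∀ x ∈ closure Ω, u₀ x ≤ v x 0) ∧
  ∀ φ : Euc N × ℝ → ℝ, ContDiff ℝ 2 φ → ∀ x₀ : Euc N, ∀ t₀ : ℝ,
    (x₀, t₀) ∈ closure Ω ×ˢ Ioc 0 T →
    IsLocalMinOn (fun p : Euc N × ℝ => v p.1 p.2 - φ p) (closure Ω ×ˢ Ioc 0 T) (x₀, t₀) →
      (x₀ ∈ Ω → 0 ≤ parOp f lam m φ (v x₀ t₀) x₀ t₀) ∧
      (x₀ ∈ frontier Ω →
        0 ≤ max (parOp f lam m φ (v x₀ t₀) x₀ t₀) (v x₀ t₀ - g x₀))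

/-- A continuous viscosity solution, global in time, of `E(Ω,f,g,u₀,λ)`. -/
def IsGlobalParSol {N : ℕ} (Ω : Set (Euc N)) (f g u₀ : Euc N → ℝ) (lam m : ℝ)
    (u : Euc N → ℝ → ℝ) : Prop :=
  ContinuousOn (fun p : Euc N × ℝ => u p.1 p.2) (closure Ω ×ˢ Ici 0) ∧
  ∀ T > (0 : ℝ), IsParSub Ω f g u₀ lam m T u ∧ IsParSuper Ω f g u₀ lam m T u

open scoped Classical in
/-- Redefinition of a parabolic subsolution on the lateral boundary by its
`limsup` from inside `Ω × (0,T]`. -/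
noncomputable def uscExtPar {N : ℕ} (Ω : Set (Euc N)) (T : ℝ)
    (u : Euc N → ℝ → ℝ) : Euc N → ℝ → ℝ :=
  fun z t => if z ∈ Ω then u z t
    else limsup (fun p : Euc N × ℝ => u p.1 p.2) (𝓝[Ω ×ˢ Ioc 0 T] (z, t))

open scoped Classical in
/-- Redefinition of a stationary subsolution on the boundary by its `limsup`
from inside `Ω`. -/
noncomputable def uscExtStat {N : ℕ} (Ω : Set (Euc N))
    (u : Euc N → ℝ) : Euc N → ℝ :=
  fun z => if z ∈ Ω then u z else limsup u (𝓝[Ω] z)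

/-- Continuous viscosity solution of the state constraint problem
`−Δw + |Dw|^m + λ w = h` in `Ω`, `−Δw + |Dw|^m + λ w ≥ h` on `∂Ω`. -/
def IsSCSolution {N : ℕ} (Ω : Set (Euc N)) (h : Euc N → ℝ) (lam m : ℝ)
    (w : Euc N → ℝ) : Prop :=
  ContinuousOn w (closure Ω) ∧
  (∀ φ : Euc N → ℝ, ContDiff ℝ 2 φ → ∀ x₀ ∈ Ω, IsLocalMaxOn (w - φ) Ω x₀ →
      statOp h lam m φ (w x₀) x₀ ≤ 0) ∧
  (∀ φ : Euc N → ℝ, ContDiff ℝ 2 φ → ∀ x₀ ∈ closure Ω,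
      IsLocalMinOn (w - φ) (closure Ω) x₀ → 0 ≤ statOp h lam m φ (w x₀) x₀)

/-- Continuous viscosity subsolution of `−Δu + |Du|^m ≤ h` in `Ω`
(no boundary condition). -/
def IsIntSub {N : ℕ} (Ω : Set (Euc N)) (h : Euc N → ℝ) (m : ℝ)
    (u : Euc N → ℝ) : Prop :=
  ∀ φ : Euc N → ℝ, ContDiff ℝ 2 φ → ∀ x₀ ∈ Ω, IsLocalMaxOn (u - φ) Ω x₀ →
    statOp h 0 m φ (u x₀) x₀ ≤ 0

/-- Hölder continuity with exponent `α` on a set. -/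
def HolderOnCl {N : ℕ} (α : ℝ) (s : Set (Euc N)) (w : Euc N → ℝ) : Prop :=
  ∃ C > (0 : ℝ), ∀ x ∈ s, ∀ y ∈ s, |w x - w y| ≤ C * ‖x - y‖ ^ α

/-- Local Lipschitz continuity inside `Ω`. -/
def LocLipIn {N : ℕ} (Ω : Set (Euc N)) (w : Euc N → ℝ) : Prop :=
  ∀ x ∈ Ω, ∃ ε > (0 : ℝ), ∃ K : ℝ, 0 ≤ K ∧
    ∀ y ∈ ball x ε ∩ Ω, ∀ z ∈ ball x ε ∩ Ω, |w y - w z| ≤ K * ‖y - z‖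

/-- A piecewise `C¹` path parametrized on `[0,1]`. -/
def IsPWC1Path {N : ℕ} (γ : ℝ → Euc N) : Prop :=
  ContinuousOn γ (Icc 0 1) ∧
  ∃ n : ℕ, ∃ τ : Fin (n + 1) → ℝ, StrictMono τ ∧ τ 0 = 0 ∧ τ (Fin.last n) = 1 ∧
    ∀ i : Fin n, ContDiffOn ℝ 1 γ (Icc (τ i.castSucc) (τ i.succ))

/-- The length of a path on `[0,1]`. -/
noncomputable def pathLen {N : ℕ} (γ : ℝ → Euc N) : ℝ :=
  ∫ t in (0 : ℝ)..1, ‖derivWithin γ (Icc (0 : ℝ) 1) t‖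

/-- The geodesic-type distance inside `closure S` via piecewise `C¹` paths. -/
noncomputable def dTilde {N : ℕ} (S : Set (Euc N)) (x y : Euc N) : ℝ :=
  sInf {L : ℝ | ∃ γ : ℝ → Euc N, IsPWC1Path γ ∧ γ 0 = x ∧ γ 1 = y ∧
    MapsTo γ (Icc 0 1) (closure S) ∧ L = pathLen γ}

/-- The inner parallel set `Ω_δ = {x ∈ Ω : dist(x,∂Ω) > δ}`. -/
def innerSet {N : ℕ} (Ω : Set (Euc N)) (δ : ℝ) : Set (Euc N) :=
  {x ∈ Ω | δ < infDist x (frontier Ω)}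

end

theorem lapl_eq_sum_fderiv {N : ℕ} (φ : Euc N → ℝ) (x : Euc N) :
    lapl φ x = ∑ i : Fin N, fderiv ℝ (fderiv ℝ φ) x (EuclideanSpace.single i 1)
      (EuclideanSpace.single i 1) := by
  simp [lapl, iteratedFDeriv_two_apply]

theorem hasDerivAt_add_smul {E : Type*} [NormedAddCommGroup E] [NormedSpace ℝ E]
    (x e : E) (s : ℝ) : HasDerivAt (fun s : ℝ => x + s • e) e s := by
  simpa using ((hasDerivAt_id s).smul_const e).const_add x

theorem hasDerivAt_line {E : Type*} [NormedAddCommGroup E] [NormedSpace ℝ E] {φ : E → ℝ}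
    (hφ : ContDiff ℝ 2 φ) (x e : E) (s : ℝ) :
    HasDerivAt (fun s : ℝ => φ (x + s • e)) (fderiv ℝ φ (x + s • e) e) s :=
  ((hφ.differentiable two_ne_zero).differentiableAt.hasFDerivAt).comp_hasDerivAt s
    (hasDerivAt_add_smul x e s)

theorem hasDerivAt_fderiv_line {E : Type*} [NormedAddCommGroup E] [NormedSpace ℝ E] {φ : E → ℝ}
    (hφ : ContDiff ℝ 2 φ) (x e : E) (s : ℝ) :
    HasDerivAt (fun s : ℝ => fderiv ℝ φ (x + s • e) e)
      (fderiv ℝ (fderiv ℝ φ) (x + s • e) e e) s := by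
  have h1 : ContDiff ℝ 1 (fderiv ℝ φ) := hφ.fderiv_right (by norm_num)
  have h2 := ((h1.differentiable one_ne_zero).differentiableAt.hasFDerivAt).comp_hasDerivAt s
    (hasDerivAt_add_smul x e s)
  simpa using h2.clm_apply (hasDerivAt_const s e)

/-- The Laplacian computed from one-dimensional derivatives along the coordinate lines. -/
theorem lapl_eq_sum_of_lines {N : ℕ} {φ : Euc N → ℝ} (hφ : ContDiff ℝ 2 φ) (x : Euc N)
    {g : Fin N → ℝ → ℝ} {c : Fin N → ℝ}
    (h1 : ∀ i s, HasDerivAt (fun s : ℝ => φ (x + s • EuclideanSpace.single i (1 : ℝ))) (g i s) s)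
    (h2 : ∀ i, HasDerivAt (g i) (c i) 0) : lapl φ x = ∑ i, c i := by
  rw [lapl_eq_sum_fderiv]
  refine Finset.sum_congr rfl fun i _ => ?_
  have h := hasDerivAt_fderiv_line hφ x (EuclideanSpace.single i (1 : ℝ)) 0
  have hg : (fun s : ℝ => fderiv ℝ φ (x + s • EuclideanSpace.single i (1 : ℝ))
      (EuclideanSpace.single i (1 : ℝ))) = g i :=
    funext fun s => (hasDerivAt_line hφ x _ s).unique (h1 i s)
  rw [hg] at h
  simpa using h.unique (h2 i)

theorem lapl_add {N : ℕ} {φ ψ : Euc N → ℝ} (hφ : ContDiff ℝ 2 φ) (hψ : ContDiff ℝ 2 ψ)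
    (x : Euc N) : lapl (φ + ψ) x = lapl φ x + lapl ψ x := by
  simp [lapl, iteratedFDeriv_add_apply hφ.contDiffAt hψ.contDiffAt, Finset.sum_add_distrib]

theorem lapl_neg {N : ℕ} (φ : Euc N → ℝ) (x : Euc N) : lapl (-φ) x = -lapl φ x := by
  simp [lapl, iteratedFDeriv_neg_apply]

theorem lapl_const_smul {N : ℕ} {φ : Euc N → ℝ} (hφ : ContDiff ℝ 2 φ) (r : ℝ) (x : Euc N) :
    lapl (r • φ) x = r * lapl φ x := by
  simp [lapl, iteratedFDeriv_const_smul_apply hφ.contDiffAt, Finset.mul_sum]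

theorem lapl_comp_add_right {N : ℕ} (φ : Euc N → ℝ) (v x : Euc N) :
    lapl (fun y => φ (y + v)) x = lapl φ (x + v) := by
  simp [lapl, iteratedFDeriv_comp_add_right]

theorem ContDiff.continuous_lapl {N : ℕ} {φ : Euc N → ℝ} (hφ : ContDiff ℝ 2 φ) :
    Continuous (lapl φ) := by
  have h : Continuous (iteratedFDeriv ℝ 2 φ) := hφ.continuous_iteratedFDeriv le_rfl
  unfold lapl
  refine continuous_finsetSum _ fun i _ => ?_
  exact (ContinuousMultilinearMap.apply ℝ (fun _ : Fin 2 => Euc N) ℝ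
    ![EuclideanSpace.single i 1, EuclideanSpace.single i 1]).continuous.comp h

/-- Second derivative test along a line. -/
theorem IsLocalMax.second_deriv_nonpos {h g : ℝ → ℝ} {c s : ℝ} (hmax : IsLocalMax h s)
    (h1 : ∀ s, HasDerivAt h (g s) s) (h2 : HasDerivAt g c s) : c ≤ 0 := by
  by_contra! hc
  have hg : deriv h = g := funext fun s => (h1 s).deriv
  have hmin : IsLocalMin h s := by
    refine isLocalMin_of_deriv_deriv_pos ?_ hmax.deriv_eq_zero (h1 s).continuousAt
    rw [hg, h2.deriv]; exact hc
  have heq : h =ᶠ[𝓝 s] fun _ => h s := by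
    filter_upwards [hmax, hmin] with t a b using le_antisymm a b
  have : deriv (deriv h) s = 0 := by
    have := heq.deriv
    rw [this.deriv_eq]; simp
  rw [hg, h2.deriv] at this
  exact hc.ne' this

theorem IsLocalMax.lapl_nonpos {N : ℕ} {φ : Euc N → ℝ} (hφ : ContDiff ℝ 2 φ) {x : Euc N}
    (hx : IsLocalMax φ x) : lapl φ x ≤ 0 := by
  rw [lapl_eq_sum_fderiv]
  refine Finset.sum_nonpos fun i _ => ?_
  set e : Euc N := EuclideanSpace.single i (1 : ℝ)
  have hl : IsLocalMax (fun s : ℝ => φ (x + s • e)) 0 := by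
    have hc : Tendsto (fun s : ℝ => x + s • e) (𝓝 0) (𝓝 x) := by
      have : Continuous (fun s : ℝ => x + s • e) := by fun_prop
      simpa using this.tendsto 0
    have := hc.eventually hx
    simpa [IsLocalMax, IsMaxFilter] using this
  simpa using hl.second_deriv_nonpos (hasDerivAt_line hφ x e) (hasDerivAt_fderiv_line hφ x e 0)

/-- Differentiation under the integral sign against a compactly supported continuous density. -/
theorem hasDerivAt_integral_mul_of_hasCompactSupport {E : Type*} [NormedAddCommGroup E]
    [MeasurableSpace E] [BorelSpace E] {μ : Measure E} [IsFiniteMeasureOnCompacts μ]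
    {u : E → ℝ} (hu : Continuous u) (huc : HasCompactSupport u)
    {k k' : ℝ → E → ℝ} {U : Set ℝ} (hU : IsOpen U) {s₀ : ℝ} (hs₀ : s₀ ∈ U)
    (hk : ContinuousOn (fun p : ℝ × E => k p.1 p.2) (U ×ˢ univ))
    (hk' : ContinuousOn (fun p : ℝ × E => k' p.1 p.2) (U ×ˢ univ))
    (hd : ∀ s ∈ U, ∀ y, HasDerivAt (fun s => k s y) (k' s y) s) :
    HasDerivAt (fun s => ∫ y, k s y * u y ∂μ) (∫ y, k' s₀ y * u y ∂μ) s₀ := by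
  obtain ⟨ε, hε, hεU⟩ := Metric.nhds_basis_closedBall.mem_iff.1 (hU.mem_nhds hs₀)
  have hcomp : IsCompact (closedBall s₀ ε ×ˢ tsupport u) := (isCompact_closedBall s₀ ε).prod huc
  obtain ⟨C, hC⟩ := hcomp.exists_bound_of_continuousOn
    (hk'.mono (prod_mono hεU (subset_univ _)))
  have slice : ∀ {q : ℝ → E → ℝ}, ContinuousOn (fun p : ℝ × E => q p.1 p.2) (U ×ˢ univ) →
      ∀ s ∈ U, Continuous (fun y => q s y * u y) := by
    intro q hq s hs
    refine Continuous.mul ?_ hu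
    exact hq.comp_continuous (f := fun y : E => (s, y)) (by fun_prop) fun y => ⟨hs, mem_univ _⟩
  have supp : ∀ (q : E → ℝ), HasCompactSupport (fun y => q y * u y) := fun q => huc.mul_left
  refine (hasDerivAt_integral_of_dominated_loc_of_deriv_le
    (F := fun s y => k s y * u y) (F' := fun s y => k' s y * u y)
    (bound := fun y => C * ‖u y‖) (closedBall_mem_nhds s₀ hε) ?_ ?_ ?_ ?_ ?_ ?_).2
  · filter_upwards [hU.mem_nhds hs₀] with s hs
    exact ((slice hk s hs).integrable_of_hasCompactSupport (supp _)).aestronglyMeasurable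
  · exact (slice hk s₀ hs₀).integrable_of_hasCompactSupport (supp _)
  · exact ((slice hk' s₀ hs₀).integrable_of_hasCompactSupport (supp _)).aestronglyMeasurable
  · refine Eventually.of_forall fun y s hs => ?_
    by_cases hy : y ∈ tsupport u
    · rw [norm_mul]
      exact mul_le_mul_of_nonneg_right (hC (s, y) ⟨hs, hy⟩) (norm_nonneg _)
    · simp [image_eq_zero_of_notMem_tsupport hy]
  · exact ((hu.integrable_of_hasCompactSupport huc).norm).const_mul C
  · exact Eventually.of_forall fun y s hs => (hd s (hεU hs) y).mul_const _

/-- The heat kernel with constant drift `b`, started at `y`. -/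
noncomputable def heatKer {N : ℕ} (b : Euc N) (t : ℝ) (x y : Euc N) : ℝ :=
  (4 * Real.pi) ^ (-(N : ℝ) / 2) * t ^ (-(N : ℝ) / 2) *
    Real.exp (-‖x - t • b - y‖ ^ 2 / (4 * t))

/-- The standard heat weight, of total mass one. -/
noncomputable def heatWeight {N : ℕ} (z : Euc N) : ℝ :=
  (4 * Real.pi) ^ (-(N : ℝ) / 2) * Real.exp (-(1 / 4) * ‖z‖ ^ 2)

/-- The evolution of `u` under `v_t = Δv - b · Dv`. -/
noncomputable def heatFlow {N : ℕ} (u : Euc N → ℝ) (b x : Euc N) (t : ℝ) : ℝ :=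
  ∫ z, heatWeight z * u (x - t • b - √t • z)

theorem heatWeight_nonneg {N : ℕ} (z : Euc N) : 0 ≤ heatWeight z := by
  unfold heatWeight; positivity

theorem continuous_heatWeight {N : ℕ} : Continuous (heatWeight (N := N)) := by
  unfold heatWeight; fun_prop

theorem integral_heatWeight {N : ℕ} : ∫ z : Euc N, heatWeight z = 1 := by
  simp only [heatWeight]
  rw [integral_const_mul, GaussianFourier.integral_rexp_neg_mul_sq_norm (by norm_num)]
  have h : Real.pi / (1 / 4) = 4 * Real.pi := by ring
  rw [h, finrank_euclideanSpace_fin, ← Real.rpow_add (by positivity)]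
  ring_nf
  simp

theorem integrable_heatWeight {N : ℕ} : Integrable (heatWeight (N := N)) := by
  by_contra h
  have := integral_heatWeight (N := N)
  rw [integral_undef h] at this
  exact zero_ne_one this

theorem abs_heatFlow_le {N : ℕ} {u : Euc N → ℝ} {M : ℝ} (hM : ∀ x, |u x| ≤ M)
    (b x : Euc N) (t : ℝ) : |heatFlow u b x t| ≤ M := by
  have h : ‖heatFlow u b x t‖ ≤ ∫ z : Euc N, heatWeight z * M := by
    refine norm_integral_le_of_norm_le (integrable_heatWeight.mul_const M) ?_
    refine Eventually.of_forall fun z => ?_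
    rw [norm_mul, Real.norm_of_nonneg (heatWeight_nonneg z)]
    exact mul_le_mul_of_nonneg_left (hM _) (heatWeight_nonneg z)
  rwa [integral_mul_const, integral_heatWeight, one_mul] at h

theorem heatFlow_zero {N : ℕ} (u : Euc N → ℝ) (b x : Euc N) : heatFlow u b x 0 = u x := by
  simp [heatFlow, integral_mul_const, integral_heatWeight]

theorem heatFlow_neg {N : ℕ} (u : Euc N → ℝ) (b x : Euc N) (t : ℝ) :
    heatFlow (-u) b x t = -heatFlow u b x t := by
  simp [heatFlow, integral_neg]

theorem continuous_heatFlow {N : ℕ} {u : Euc N → ℝ} (hu : Continuous u) {M : ℝ}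
    (hM : ∀ x, |u x| ≤ M) (b : Euc N) :
    Continuous (fun p : Euc N × ℝ => heatFlow u b p.1 p.2) := by
  unfold heatFlow
  refine continuous_of_dominated (bound := fun z => heatWeight z * M) ?_ ?_
    (integrable_heatWeight.mul_const M) ?_
  · intro p
    exact (continuous_heatWeight.mul (hu.comp (by fun_prop))).aestronglyMeasurable
  · refine fun p => Eventually.of_forall fun z => ?_
    rw [norm_mul, Real.norm_of_nonneg (heatWeight_nonneg z)]
    exact mul_le_mul_of_nonneg_left (hM _) (heatWeight_nonneg z)
  · refine Eventually.of_forall fun z => ?_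
    exact continuous_const.mul (hu.comp (by fun_prop))

theorem heatFlow_eq_integral_heatKer {N : ℕ} (u : Euc N → ℝ) (b x : Euc N) {t : ℝ} (ht : 0 < t) :
    heatFlow u b x t = ∫ y, heatKer b t x y * u y := by
  have hs : 0 < √t := Real.sqrt_pos.2 ht
  have h1 := Measure.integral_comp_smul (volume : Measure (Euc N))
    (fun z => heatWeight ((√t)⁻¹ • z) * u (x - t • b - z)) (√t)
  have h2 := integral_sub_left_eq_self (μ := (volume : Measure (Euc N)))
    (fun y => heatWeight ((√t)⁻¹ • (x - t • b - y)) * u y) (x - t • b)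
  simp only [sub_sub_cancel] at h2
  have h3 : ∀ z : Euc N, (√t)⁻¹ • (√t • z) = z := fun z => inv_smul_smul₀ hs.ne' z
  simp only [h3] at h1
  unfold heatFlow
  rw [h1, h2, smul_eq_mul, ← integral_const_mul]
  refine integral_congr_ae (Eventually.of_forall fun y => ?_)
  have h4 : |((√t) ^ Module.finrank ℝ (Euc N))⁻¹| = t ^ (-(N : ℝ) / 2) := by
    rw [abs_of_pos (by positivity), finrank_euclideanSpace_fin, Real.sqrt_eq_rpow,
      ← Real.rpow_natCast, ← Real.rpow_mul ht.le, ← Real.rpow_neg ht.le]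
    congr 1; ring
  have h5 : -(1 / 4) * ‖(√t)⁻¹ • (x - t • b - y)‖ ^ 2 = -‖x - t • b - y‖ ^ 2 / (4 * t) := by
    rw [norm_smul, mul_pow, norm_inv, Real.norm_of_nonneg hs.le, inv_pow, Real.sq_sqrt ht.le]
    field_simp
  simp only [heatWeight, heatKer]
  rw [h4, h5]
  ring

theorem ContDiff.heatKer {N : ℕ} {P : Type*} [NormedAddCommGroup P] [NormedSpace ℝ P]
    {f g : P → Euc N} (hf : ContDiff ℝ 2 f) (hg : ContDiff ℝ 2 g) (b : Euc N) (t : ℝ) :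
    ContDiff ℝ 2 (fun p => heatKer b t (f p) (g p)) := by
  unfold _root_.heatKer
  refine contDiff_const.mul (Real.contDiff_exp.comp ?_)
  refine ContDiff.div_const (ContDiff.neg ?_) _
  exact ((hf.sub contDiff_const).sub hg).norm_sq ℝ

theorem contDiff_integral_heatKer {N : ℕ} {u : Euc N → ℝ} (hu : Continuous u)
    (huc : HasCompactSupport u) (b : Euc N) (t : ℝ) :
    ContDiff ℝ 2 (fun x => ∫ y, heatKer b t x y * u y) := by
  obtain ⟨R, hR, hRs⟩ := huc.isCompact.isBounded.subset_closedBall_lt 0 (0 : Euc N)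
  let χ : ContDiffBump (0 : Euc N) := ⟨R, R + 1, hR, by linarith⟩
  have hχ : ContDiff ℝ 2 (fun p : Euc N × Euc N => χ (-p.2)) := χ.contDiff.comp contDiff_snd.neg
  have h2 : ((2 : ℕ∞) : WithTop ℕ∞) = 2 := by norm_cast
  have hg : ContDiff ℝ ((2 : ℕ∞) : WithTop ℕ∞)
      (fun p : Euc N × Euc N => χ (-p.2) * heatKer b t p.1 (-p.2)) := by
    rw [h2]
    exact hχ.mul (contDiff_fst.heatKer contDiff_snd.neg b t)
  have h := contDiffOn_convolution_right_with_param_comp (𝕜 := ℝ) (n := 2)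
    (μ := (volume : Measure (Euc N))) (f := u) (P := Euc N)
    (ContinuousLinearMap.mul ℝ ℝ) (s := univ) (v := fun _ => (0 : Euc N))
    (g := fun x y => χ (-y) * heatKer b t x (-y)) (k := closedBall 0 (R + 1))
    contDiffOn_const isOpen_univ (isCompact_closedBall _ _) ?_
    hu.locallyIntegrable hg.contDiffOn
  · rw [contDiffOn_univ, h2] at h
    convert h using 1
    funext x
    rw [convolution_def]
    refine integral_congr_ae (Eventually.of_forall fun y => ?_)
    simp only [zero_sub, neg_neg, ContinuousLinearMap.mul_apply']
    by_cases hy : y ∈ tsupport u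
    · have : χ y = 1 := χ.one_of_mem_closedBall (hRs hy)
      rw [this]; ring
    · simp [image_eq_zero_of_notMem_tsupport hy]
  · intro x y _ hy
    have : χ (-y) = 0 := by
      apply χ.zero_of_le_dist
      simp only [mem_closedBall, dist_zero_right, not_le] at hy
      simpa using hy.le
    simp [this]

theorem hasDerivAt_norm_sq_line {N : ℕ} (ξ e : Euc N) (s : ℝ) :
    HasDerivAt (fun s : ℝ => ‖ξ + s • e‖ ^ 2) (2 * inner ℝ (ξ + s • e) e) s :=
  (hasDerivAt_add_smul ξ e s).norm_sq

theorem hasDerivAt_heatKer_line {N : ℕ} (b : Euc N) {t : ℝ} (ht : 0 < t) (x y e : Euc N) (s : ℝ) :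
    HasDerivAt (fun s : ℝ => heatKer b t (x + s • e) y)
      (-(inner ℝ (x + s • e - t • b - y) e) / (2 * t) * heatKer b t (x + s • e) y) s := by
  have h := hasDerivAt_norm_sq_line (x - t • b - y) e s
  have hx : ∀ s : ℝ, x - t • b - y + s • e = x + s • e - t • b - y := fun s => by abel
  simp only [hx] at h
  have := ((h.neg.div_const (4 * t)).exp).const_mul
    ((4 * Real.pi) ^ (-(N : ℝ) / 2) * t ^ (-(N : ℝ) / 2))
  refine this.congr_deriv ?_
  simp only [heatKer, Pi.neg_apply]
  field_simp
  ring

theorem hasDerivAt_heatKer_line_second {N : ℕ} (b : Euc N) {t : ℝ} (ht : 0 < t) (x y e : Euc N)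
    (s : ℝ) :
    HasDerivAt (fun s : ℝ => -(inner ℝ (x + s • e - t • b - y) e) / (2 * t) *
        heatKer b t (x + s • e) y)
      (((inner ℝ (x + s • e - t • b - y) e) ^ 2 / (4 * t ^ 2) - ‖e‖ ^ 2 / (2 * t)) *
        heatKer b t (x + s • e) y) s := by
  have h1 : HasDerivAt (fun s : ℝ => inner ℝ (x + s • e - t • b - y) e) (‖e‖ ^ 2) s := by
    have := (((hasDerivAt_add_smul x e s).sub_const (t • b)).sub_const y).inner ℝ
      (hasDerivAt_const s e)
    simpa using this
  refine ((h1.neg.div_const (2 * t)).mul (hasDerivAt_heatKer_line b ht x y e s)).congr_deriv ?_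
  simp only [Pi.neg_apply]
  field_simp
  ring

theorem hasDerivAt_heatKer_time {N : ℕ} (b : Euc N) {t : ℝ} (ht : 0 < t) (x y : Euc N) :
    HasDerivAt (fun t : ℝ => heatKer b t x y)
      ((‖x - t • b - y‖ ^ 2 / (4 * t ^ 2) - N / (2 * t) + inner ℝ (x - t • b - y) b / (2 * t)) *
        heatKer b t x y) t := by
  have h1 : HasDerivAt (fun t : ℝ => x - t • b - y) (-b) t := by
    simpa using (((hasDerivAt_id t).smul_const b).const_sub x).sub_const y
  have h2 := h1.norm_sq
  have h3 := (h2.neg.div ((hasDerivAt_id t).const_mul 4) (by simpa using ht.ne')).exp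
  have h4 := (Real.hasDerivAt_rpow_const (x := t) (p := -(N : ℝ) / 2) (Or.inl ht.ne')).const_mul
    ((4 * Real.pi) ^ (-(N : ℝ) / 2))
  refine (h4.mul h3).congr_deriv ?_
  simp only [heatKer, id, inner_neg_right, Pi.neg_apply, Pi.div_apply]
  rw [Real.rpow_sub ht, Real.rpow_one]
  field_simp
  ring

theorem Continuous.heatKer {N : ℕ} {P : Type*} [TopologicalSpace P] {f g : P → Euc N}
    (hf : Continuous f) (hg : Continuous g) (b : Euc N) (t : ℝ) :
    Continuous (fun p => heatKer b t (f p) (g p)) := by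
  unfold _root_.heatKer
  fun_prop

theorem heatFlow_slice_eq {N : ℕ} (u : Euc N → ℝ) (b : Euc N) {t : ℝ} (ht : 0 < t) :
    (fun x => heatFlow u b x t) = fun x => ∫ y, heatKer b t x y * u y :=
  funext fun x => heatFlow_eq_integral_heatKer u b x ht

theorem contDiff_heatFlow {N : ℕ} {u : Euc N → ℝ} (hu : Continuous u)
    (huc : HasCompactSupport u) (b : Euc N) {t : ℝ} (ht : 0 < t) :
    ContDiff ℝ 2 (fun x => heatFlow u b x t) := by
  rw [heatFlow_slice_eq u b ht]
  exact contDiff_integral_heatKer hu huc b t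

theorem hasDerivAt_heatFlow_line {N : ℕ} {u : Euc N → ℝ} (hu : Continuous u)
    (huc : HasCompactSupport u) (b : Euc N) {t : ℝ} (ht : 0 < t) (x e : Euc N) (s : ℝ) :
    HasDerivAt (fun s : ℝ => heatFlow u b (x + s • e) t)
      (∫ y, -(inner ℝ (x + s • e - t • b - y) e) / (2 * t) * heatKer b t (x + s • e) y * u y) s := by
  simp only [heatFlow_eq_integral_heatKer u b _ ht]
  refine hasDerivAt_integral_mul_of_hasCompactSupport hu huc
    (k := fun s y => heatKer b t (x + s • e) y)
    (k' := fun s y => -(inner ℝ (x + s • e - t • b - y) e) / (2 * t) * heatKer b t (x + s • e) y)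
    isOpen_univ (mem_univ s) ?_ ?_ fun s _ y => hasDerivAt_heatKer_line b ht x y e s
  · exact (Continuous.heatKer (by fun_prop) continuous_snd b t).continuousOn
  · exact (Continuous.mul (by fun_prop)
      (Continuous.heatKer (by fun_prop) continuous_snd b t)).continuousOn

theorem hasDerivAt_heatFlow_line_second {N : ℕ} {u : Euc N → ℝ} (hu : Continuous u)
    (huc : HasCompactSupport u) (b : Euc N) {t : ℝ} (ht : 0 < t) (x e : Euc N) :
    HasDerivAt (fun s : ℝ =>
        ∫ y, -(inner ℝ (x + s • e - t • b - y) e) / (2 * t) * heatKer b t (x + s • e) y * u y)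
      (∫ y, ((inner ℝ (x - t • b - y) e) ^ 2 / (4 * t ^ 2) - ‖e‖ ^ 2 / (2 * t)) *
        heatKer b t x y * u y) 0 := by
  have h := hasDerivAt_integral_mul_of_hasCompactSupport (μ := (volume : Measure (Euc N))) hu huc
    (k := fun s y => -(inner ℝ (x + s • e - t • b - y) e) / (2 * t) * heatKer b t (x + s • e) y)
    (k' := fun s y => ((inner ℝ (x + s • e - t • b - y) e) ^ 2 / (4 * t ^ 2) - ‖e‖ ^ 2 / (2 * t)) *
        heatKer b t (x + s • e) y)
    isOpen_univ (mem_univ 0) ?_ ?_ fun s _ y => hasDerivAt_heatKer_line_second b ht x y e s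
  · simpa using h
  · exact (Continuous.mul (by fun_prop)
      (Continuous.heatKer (by fun_prop) continuous_snd b t)).continuousOn
  · exact (Continuous.mul (by fun_prop)
      (Continuous.heatKer (by fun_prop) continuous_snd b t)).continuousOn

theorem hasDerivAt_heatFlow_time_integral {N : ℕ} {u : Euc N → ℝ} (hu : Continuous u)
    (huc : HasCompactSupport u) (b x : Euc N) {t : ℝ} (ht : 0 < t) :
    HasDerivAt (fun t : ℝ => heatFlow u b x t)
      (∫ y, (‖x - t • b - y‖ ^ 2 / (4 * t ^ 2) - N / (2 * t) +
        inner ℝ (x - t • b - y) b / (2 * t)) * heatKer b t x y * u y) t := by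
  have hc : ContinuousOn (fun p : ℝ × Euc N => heatKer b p.1 x p.2) (Ioi 0 ×ˢ univ) := by
    unfold heatKer
    refine ContinuousOn.mul (ContinuousOn.mul continuousOn_const ?_) ?_
    · exact continuousOn_fst.rpow_const fun p hp => Or.inl (ne_of_gt hp.1)
    · refine ContinuousOn.rexp (ContinuousOn.div (by fun_prop) (by fun_prop) fun p hp => ?_)
      have : 0 < p.1 := hp.1
      positivity
  have h := hasDerivAt_integral_mul_of_hasCompactSupport (μ := (volume : Measure (Euc N))) hu huc
    (k := fun t y => heatKer b t x y)
    (k' := fun t y => (‖x - t • b - y‖ ^ 2 / (4 * t ^ 2) - N / (2 * t) +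
        inner ℝ (x - t • b - y) b / (2 * t)) * heatKer b t x y)
    isOpen_Ioi (mem_Ioi.2 ht) hc ?_ fun s hs y => hasDerivAt_heatKer_time b hs x y
  · refine h.congr_of_eventuallyEq ?_
    filter_upwards [Ioi_mem_nhds ht] with s hs
    exact heatFlow_eq_integral_heatKer u b x hs
  · refine ContinuousOn.mul (ContinuousOn.add (ContinuousOn.sub ?_ ?_) ?_) hc
    all_goals
      refine ContinuousOn.div (by fun_prop) (by fun_prop) fun p hp => ?_
      have : 0 < p.1 := hp.1
      positivity

/-- `heatFlow` solves `v_t = Δv - b · Dv` for positive times. -/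
theorem hasDerivAt_heatFlow_time {N : ℕ} {u : Euc N → ℝ} (hu : Continuous u)
    (huc : HasCompactSupport u) (b x : Euc N) {t : ℝ} (ht : 0 < t) :
    HasDerivAt (fun t : ℝ => heatFlow u b x t)
      (lapl (fun x => heatFlow u b x t) x - fderiv ℝ (fun x => heatFlow u b x t) x b) t := by
  have hC := contDiff_heatFlow hu huc b ht
  have hL := lapl_eq_sum_of_lines hC x
    (fun i s => hasDerivAt_heatFlow_line hu huc b ht x (EuclideanSpace.single i (1 : ℝ)) s)
    (fun i => hasDerivAt_heatFlow_line_second hu huc b ht x (EuclideanSpace.single i (1 : ℝ)))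
  have hD := (hasDerivAt_line hC x b 0).unique (hasDerivAt_heatFlow_line hu huc b ht x b 0)
  simp only [zero_smul, add_zero] at hD
  have hI : ∀ q : Euc N → ℝ, Continuous q →
      Integrable (fun y => q y * heatKer b t x y * u y) := fun q hq =>
    ((hq.mul (continuous_const.heatKer continuous_id b t)).mul hu).integrable_of_hasCompactSupport
      huc.mul_left
  refine (hasDerivAt_heatFlow_time_integral hu huc b x ht).congr_deriv ?_
  rw [hL, hD, ← integral_finsetSum _ fun i _ => hI _ (by fun_prop),
    ← integral_sub (integrable_finsetSum _ fun i _ => hI _ (by fun_prop)) (hI _ (by fun_prop))]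
  refine integral_congr_ae (Eventually.of_forall fun y => ?_)
  simp only [EuclideanSpace.inner_single_right, EuclideanSpace.norm_sq_eq (x - t • b - y)]
  rw [← Finset.sum_mul, ← Finset.sum_mul, Finset.sum_sub_distrib, ← Finset.sum_div]
  simp
  ring

/-- A polynomial solution of `v_t = Δv - b · Dv` that localizes comparison arguments. -/
noncomputable def heatBarrier {N : ℕ} (b x : Euc N) (t : ℝ) : ℝ :=
  ∑ i : Fin N, ((x i - t * b i) ^ 4 + 12 * t * (x i - t * b i) ^ 2 + 12 * t ^ 2)

theorem ContDiff.heatBarrier {N : ℕ} {P : Type*} [NormedAddCommGroup P] [NormedSpace ℝ P]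
    {f : P → Euc N} {τ : P → ℝ} (hf : ContDiff ℝ 2 f) (hτ : ContDiff ℝ 2 τ) (b : Euc N) :
    ContDiff ℝ 2 (fun p => heatBarrier b (f p) (τ p)) := by
  unfold _root_.heatBarrier
  refine ContDiff.sum fun i _ => ?_
  have h : ContDiff ℝ 2 (fun p => f p i) :=
    (EuclideanSpace.proj i : Euc N →L[ℝ] ℝ).contDiff.comp hf
  fun_prop

theorem hasDerivAt_heatBarrier_time {N : ℕ} (b x : Euc N) (t : ℝ) :
    HasDerivAt (fun t : ℝ => heatBarrier b x t)
      (lapl (fun x => heatBarrier b x t) x - fderiv ℝ (fun x => heatBarrier b x t) x b) t := by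
  have hC : ContDiff ℝ 2 (fun x => heatBarrier b x t) :=
    contDiff_id.heatBarrier contDiff_const b
  have hp : ∀ (c d s : ℝ), HasDerivAt (fun s : ℝ => c + s * d) d s := fun c d s => by
    simpa using ((hasDerivAt_id s).mul_const d).const_add c
  have hline : ∀ (e : Euc N) (s : ℝ), HasDerivAt (fun s : ℝ => heatBarrier b (x + s • e) t)
      (∑ i, (4 * (x i + s * e i - t * b i) ^ 3 * e i
        + 24 * t * (x i + s * e i - t * b i) * e i)) s := by
    intro e s
    simp only [heatBarrier, PiLp.add_apply, PiLp.smul_apply, smul_eq_mul]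
    refine HasDerivAt.fun_sum fun i _ => ?_
    have h := (hp (x i) (e i) s).sub_const (t * b i)
    refine (((h.fun_pow 4).add ((h.fun_pow 2).const_mul (12 * t))).add_const _).congr_deriv ?_
    push_cast
    ring
  have hL := lapl_eq_sum_of_lines hC x
    (c := fun i => 12 * (x i - t * b i) ^ 2 + 24 * t)
    (fun i s => hline (EuclideanSpace.single i (1 : ℝ)) s) ?_
  · have hD := (hasDerivAt_line hC x b 0).unique (hline b 0)
    simp only [zero_smul, add_zero, zero_mul] at hD
    rw [hL, hD, ← Finset.sum_sub_distrib]
    unfold heatBarrier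
    refine HasDerivAt.fun_sum fun i _ => ?_
    have h : HasDerivAt (fun t : ℝ => x i - t * b i) (-b i) t := by
      simpa using ((hasDerivAt_id t).mul_const (b i)).const_sub (x i)
    refine (((h.fun_pow 4).add (((hasDerivAt_id t).const_mul 12).mul (h.fun_pow 2))).add
      (((hasDerivAt_id t).fun_pow 2).const_mul 12)).congr_deriv ?_
    simp only [id]
    push_cast
    ring
  · intro i
    have hsum : (fun s : ℝ => ∑ j, (4 * (x j + s * (EuclideanSpace.single i (1 : ℝ) : Euc N) j
        - t * b j) ^ 3 * (EuclideanSpace.single i (1 : ℝ) : Euc N) j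
        + 24 * t * (x j + s * (EuclideanSpace.single i (1 : ℝ) : Euc N) j - t * b j) *
          (EuclideanSpace.single i (1 : ℝ) : Euc N) j)) =
        fun s : ℝ => 4 * (x i + s * 1 - t * b i) ^ 3 + 24 * t * (x i + s * 1 - t * b i) := by
      funext s
      rw [Finset.sum_eq_single i]
      · simp
      · intro j _ hj
        simp [hj]
      · simp
    rw [hsum]
    have h := (hp (x i) 1 0).sub_const (t * b i)
    refine (((h.fun_pow 3).const_mul 4).add (h.const_mul (24 * t))).congr_deriv ?_
    push_cast
    ring

/-- Viscosity subsolution of the linear equation `-Δu + b · Du ≤ K` at the points of `S`. -/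
def IsLinSub {N : ℕ} (u : Euc N → ℝ) (b : Euc N) (K : ℝ) (S : Set (Euc N)) : Prop :=
  ∀ φ : Euc N → ℝ, ContDiff ℝ 2 φ → ∀ x ∈ S, IsLocalMax (u - φ) x →
    -lapl φ x + fderiv ℝ φ x b ≤ K

theorem IsLinSub.mono {N : ℕ} {u : Euc N → ℝ} {b : Euc N} {K : ℝ} {S S' : Set (Euc N)}
    (h : IsLinSub u b K S) (hS : S' ⊆ S) : IsLinSub u b K S' :=
  fun φ hφ x hx hmax => h φ hφ x (hS hx) hmax

theorem ContDiff.isLinSub {N : ℕ} {ψ : Euc N → ℝ} (hψ : ContDiff ℝ 2 ψ) {b : Euc N} {K : ℝ}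
    {S : Set (Euc N)} (h : ∀ x ∈ S, -lapl ψ x + fderiv ℝ ψ x b ≤ K) : IsLinSub ψ b K S := by
  intro φ hφ x hx hmax
  have h1 : lapl (ψ - φ) x ≤ 0 := hmax.lapl_nonpos (hψ.sub hφ)
  have hn : ContDiff ℝ 2 (-φ) := hφ.neg
  rw [sub_eq_add_neg, lapl_add hψ hn, lapl_neg] at h1
  have h2 : fderiv ℝ (ψ - φ) x = 0 := hmax.fderiv_eq_zero
  rw [fderiv_sub (hψ.differentiable two_ne_zero).differentiableAt
    (hφ.differentiable two_ne_zero).differentiableAt, sub_eq_zero] at h2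
  have := h x hx
  rw [h2] at this
  linarith

theorem heatBarrier_nonneg {N : ℕ} (b x : Euc N) {t : ℝ} (ht : 0 ≤ t) : 0 ≤ heatBarrier b x t :=
  Finset.sum_nonneg fun i _ => by positivity

theorem pow_four_le_heatBarrier {N : ℕ} (b x : Euc N) {t : ℝ} (ht : 0 ≤ t) :
    ‖x - t • b‖ ^ 4 ≤ N * heatBarrier b x t := by
  have h1 : ‖x - t • b‖ ^ 4 = (∑ i, (x i - t * b i) ^ 2) ^ 2 := by
    rw [show (4 : ℕ) = 2 * 2 from rfl, pow_mul, EuclideanSpace.norm_sq_eq]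
    simp
  have h2 : (∑ i : Fin N, (x i - t * b i) ^ 2) ^ 2 ≤ N * ∑ i, ((x i - t * b i) ^ 2) ^ 2 := by
    simpa using sq_sum_le_card_mul_sum_sq (s := Finset.univ) (f := fun i => (x i - t * b i) ^ 2)
  rw [h1]
  refine h2.trans (mul_le_mul_of_nonneg_left (Finset.sum_le_sum fun i _ => ?_) (Nat.cast_nonneg N))
  have : 0 ≤ 12 * t * (x i - t * b i) ^ 2 := by positivity
  nlinarith [sq_nonneg t]

theorem heatBarrier_zero_le {N : ℕ} (b : Euc N) {t : ℝ} (ht : 0 ≤ t) (ht1 : t ≤ 1) :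
    heatBarrier b 0 t ≤ (∑ i, ((b i) ^ 4 + 12 * (b i) ^ 2 + 12)) * t ^ 2 := by
  unfold heatBarrier
  rw [Finset.sum_mul]
  refine Finset.sum_le_sum fun i _ => ?_
  have h2 : t ^ 2 ≤ 1 := pow_le_one₀ ht ht1
  have h4 : (t ^ 2 * t ^ 2) * (b i) ^ 4 ≤ t ^ 2 * (b i) ^ 4 :=
    mul_le_mul_of_nonneg_right (by nlinarith [sq_nonneg t]) (by positivity)
  have h3 : (t * t ^ 2) * (b i) ^ 2 ≤ t ^ 2 * (b i) ^ 2 :=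
    mul_le_mul_of_nonneg_right (by nlinarith [sq_nonneg t]) (by positivity)
  simp only [PiLp.zero_apply]
  nlinarith

theorem HasDerivAt.nonneg_of_le_left {h : ℝ → ℝ} {h' t : ℝ} (hd : HasDerivAt h h' t)
    (hle : ∀ᶠ s in 𝓝[<] t, h s ≤ h t) : 0 ≤ h' := by
  have hs := (hasDerivAt_iff_tendsto_slope.1 hd).mono_left
    (nhdsWithin_mono t (show Iio t ⊆ {t}ᶜ from fun s hs => ne_of_lt hs))
  refine ge_of_tendsto hs ?_
  filter_upwards [hle, self_mem_nhdsWithin] with s h1 h2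
  rw [slope_def_field]
  exact div_nonneg_of_nonpos (by linarith) (by simpa using (le_of_lt h2))

/-- Short-time comparison of a viscosity subsolution of `-Δu + b · Du ≤ K` with its evolution. -/
theorem IsLinSub.le_heatFlow {N : ℕ} (M K : ℝ) {r : ℝ} (hr : 0 < r) (b : Euc N) :
    ∃ C : ℝ, ∃ t₀ > 0, ∀ u : Euc N → ℝ, Continuous u → HasCompactSupport u → (∀ x, |u x| ≤ M) →
      ∀ x₀, IsLinSub u b K (ball x₀ r) → ∀ t, 0 < t → t ≤ t₀ →
        u x₀ ≤ heatFlow u b x₀ t + K * t + C * t ^ 2 := by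
  set Q : ℝ := 2 * |M| + |K| + 2
  have hQ : 0 < Q := by positivity
  set A : ℝ := 16 * Q * N / r ^ 4
  have hA : 0 ≤ A := by positivity
  refine ⟨A * ∑ i, ((b i) ^ 4 + 12 * (b i) ^ 2 + 12), min 1 (r / (2 * (‖b‖ + 1))),
    by positivity, ?_⟩
  intro u hu huc hM x₀ hsub T hT hT0
  have hT1 : T ≤ 1 := hT0.trans (min_le_left _ _)
  have hTb : ∀ t, 0 ≤ t → t ≤ T → t * ‖b‖ ≤ r / 2 := by
    intro t ht htT
    have h1 : t ≤ r / (2 * (‖b‖ + 1)) := htT.trans (hT0.trans (min_le_right _ _))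
    rw [le_div_iff₀ (by positivity)] at h1
    nlinarith [norm_nonneg b]
  have key : ∀ η : ℝ, 0 < η → η ≤ 1 →
      u x₀ - heatFlow u b x₀ T - (K + η) * T - A * heatBarrier b (x₀ - x₀) T ≤ 0 := by
    intro η hη hη1
    by_contra! hpos
    let e : Euc N × ℝ → ℝ := fun p =>
      u p.1 - heatFlow u b p.1 p.2 - (K + η) * p.2 - A * heatBarrier b (p.1 - x₀) p.2
    have hB : Continuous (fun p : Euc N × ℝ => heatBarrier b (p.1 - x₀) p.2) :=
      ((contDiff_fst.sub contDiff_const).heatBarrier contDiff_snd b).continuous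
    have he : Continuous e :=
      (((hu.comp continuous_fst).sub (continuous_heatFlow hu hM b)).sub (by fun_prop)).sub
        (continuous_const.mul hB)
    have hcomp : IsCompact (closedBall x₀ r ×ˢ Icc 0 T) :=
      (isCompact_closedBall x₀ r).prod isCompact_Icc
    have hmem : (x₀, T) ∈ closedBall x₀ r ×ˢ Icc 0 T :=
      ⟨mem_closedBall_self hr.le, hT.le, le_rfl⟩
    obtain ⟨⟨x, t⟩, ⟨hx, ht0, htT⟩, hmax⟩ := hcomp.exists_isMaxOn ⟨_, hmem⟩ he.continuousOn
    simp only at hx ht0 htT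
    have hepos : 0 < e (x, t) := lt_of_lt_of_le hpos (hmax hmem)
    have htpos : 0 < t := by
      refine lt_of_le_of_ne ht0 fun h0 => ?_
      subst h0
      simp only [e, heatFlow_zero, sub_self, mul_zero] at hepos
      have := mul_nonneg hA (heatBarrier_nonneg b (x - x₀) le_rfl)
      linarith
    have hxr : x ∈ ball x₀ r := by
      refine mem_ball.2 (lt_of_le_of_ne (mem_closedBall.1 hx) fun hxr => ?_)
      rw [dist_eq_norm] at hxr
      have h1 : r / 2 ≤ ‖x - x₀ - t • b‖ := by
        have h2 := norm_sub_norm_le (x - x₀) (t • b)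
        rw [norm_smul, Real.norm_of_nonneg ht0, hxr] at h2
        have := hTb t ht0 htT
        linarith
      have h2 : (r / 2) ^ 4 ≤ N * heatBarrier b (x - x₀) t :=
        (pow_le_pow_left₀ (by positivity) h1 4).trans (pow_four_le_heatBarrier b _ ht0)
      have h3 : Q ≤ A * heatBarrier b (x - x₀) t := by
        have h4 : A * heatBarrier b (x - x₀) t =
            16 * Q / r ^ 4 * (N * heatBarrier b (x - x₀) t) := by
          simp only [A]; ring
        have h5 : Q = 16 * Q / r ^ 4 * (r / 2) ^ 4 := by field_simp; norm_num
        rw [h4]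
        calc Q = 16 * Q / r ^ 4 * (r / 2) ^ 4 := h5
          _ ≤ _ := mul_le_mul_of_nonneg_left h2 (by positivity)
      have h4 := abs_le.1 ((hM x).trans (le_abs_self M))
      have h5 := abs_le.1 ((abs_heatFlow_le hM b x t).trans (le_abs_self M))
      have h6 : -(K + η) * t ≤ |K| + 1 := by
        have : -(K + η) * t ≤ |K| * t := by
          apply mul_le_mul_of_nonneg_right _ ht0
          linarith [neg_abs_le K]
        have : |K| * t ≤ |K| * 1 := mul_le_mul_of_nonneg_left (htT.trans hT1) (abs_nonneg K)
        linarith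
      simp only [e] at hepos
      simp only [Q] at h3
      linarith [h4.2, h5.1]
    have hF := contDiff_heatFlow hu huc b htpos
    have hBx : ContDiff ℝ 2 (fun y : Euc N => heatBarrier b y t) :=
      contDiff_id.heatBarrier contDiff_const b
    have hBx' : ContDiff ℝ 2 (fun y : Euc N => heatBarrier b (y + -x₀) t) :=
      (contDiff_id.add contDiff_const).heatBarrier contDiff_const b
    have hAB : ContDiff ℝ 2 (A • fun y => heatBarrier b (y + -x₀) t) := contDiff_const.smul hBx'
    let φ : Euc N → ℝ := (fun y => heatFlow u b y t) + A • fun y => heatBarrier b (y + -x₀) t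
    have hφ : ContDiff ℝ 2 φ := hF.add hAB
    have hlm : IsLocalMax (u - φ) x := by
      filter_upwards [isOpen_ball.mem_nhds hxr] with y hy
      have := hmax (show (y, t) ∈ closedBall x₀ r ×ˢ Icc 0 T from
        ⟨ball_subset_closedBall hy, ht0, htT⟩)
      simp only [e, mem_ofPred_eq] at this
      simp only [φ, Pi.sub_apply, Pi.add_apply, Pi.smul_apply, smul_eq_mul, ← sub_eq_add_neg]
      linarith
    have hvisc := hsub φ hφ x hxr hlm
    have hlap : lapl φ x = lapl (fun y => heatFlow u b y t) x +
        A * lapl (fun y => heatBarrier b y t) (x - x₀) := by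
      rw [show φ = (fun y => heatFlow u b y t) + A • fun y => heatBarrier b (y + -x₀) t from rfl,
        lapl_add hF hAB, lapl_const_smul hBx',
        lapl_comp_add_right (fun y => heatBarrier b y t), ← sub_eq_add_neg]
    have hder : fderiv ℝ φ x b = fderiv ℝ (fun y => heatFlow u b y t) x b +
        A * fderiv ℝ (fun y => heatBarrier b y t) (x - x₀) b := by
      have hd := (hBx'.differentiable two_ne_zero).differentiableAt (x := x)
      rw [show φ = (fun y => heatFlow u b y t) + A • fun y => heatBarrier b (y + -x₀) t from rfl,
        fderiv_add (hF.differentiable two_ne_zero).differentiableAt (hd.const_smul A),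
        fderiv_const_smul hd, fderiv_comp_add_right (f := fun y => heatBarrier b y t)]
      simp [← sub_eq_add_neg]
    have htime := (((hasDerivAt_const t (u x)).sub (hasDerivAt_heatFlow_time hu huc b x htpos)).sub
      ((hasDerivAt_id t).const_mul (K + η))).sub
      ((hasDerivAt_heatBarrier_time b (x - x₀) t).const_mul A)
    have hnn := htime.nonneg_of_le_left (by
      filter_upwards [Ioo_mem_nhdsLT htpos] with s hs
      exact hmax (show (x, s) ∈ closedBall x₀ r ×ˢ Icc 0 T from
        ⟨hx, hs.1.le, hs.2.le.trans htT⟩))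
    rw [hlap, hder] at hvisc
    linarith
  have hb0 := mul_le_mul_of_nonneg_left (heatBarrier_zero_le b hT.le hT1) hA
  refine le_of_forall_pos_le_add fun η hη => ?_
  have h1 := key (min η 1) (lt_min hη one_pos) (min_le_right _ _)
  rw [sub_self] at h1
  have h2 : min η 1 * T ≤ η := by
    have : min η 1 * T ≤ min η 1 * 1 := mul_le_mul_of_nonneg_left hT1 (by positivity)
    linarith [min_le_left η 1]
  linarith

/-- The mollification of `u` by the normalized bump function `ρ`. -/
noncomputable def mollify {N : ℕ} (ρ : ContDiffBump (0 : Euc N)) (u : Euc N → ℝ) : Euc N → ℝ :=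
  MeasureTheory.convolution (ρ.normed volume) u (ContinuousLinearMap.lsmul ℝ ℝ) volume

theorem mollify_apply {N : ℕ} (ρ : ContDiffBump (0 : Euc N)) (u : Euc N → ℝ) (x : Euc N) :
    mollify ρ u x = ∫ y, ρ.normed volume y * u (x - y) := rfl

theorem contDiff_mollify {N : ℕ} (ρ : ContDiffBump (0 : Euc N)) {u : Euc N → ℝ}
    (hu : Continuous u) : ContDiff ℝ 2 (mollify ρ u) := by
  have h2 : ((2 : ℕ∞) : WithTop ℕ∞) = 2 := by norm_cast
  rw [← h2]
  exact ρ.hasCompactSupport_normed.contDiff_convolution_left _ ρ.contDiff_normed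
    hu.locallyIntegrable

theorem hasCompactSupport_mollify {N : ℕ} (ρ : ContDiffBump (0 : Euc N)) {u : Euc N → ℝ}
    (huc : HasCompactSupport u) : HasCompactSupport (mollify ρ u) :=
  ρ.hasCompactSupport_normed.convolution _ huc

theorem heatFlow_mollify {N : ℕ} (ρ : ContDiffBump (0 : Euc N)) {u : Euc N → ℝ}
    (hu : Continuous u) {M : ℝ} (hM : ∀ x, |u x| ≤ M) (b x : Euc N) (t : ℝ) :
    heatFlow (mollify ρ u) b x t = ∫ y, ρ.normed volume y * heatFlow u b (x - y) t := by
  simp only [heatFlow, mollify_apply, ← integral_const_mul]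
  rw [integral_integral_swap]
  · refine integral_congr_ae (Eventually.of_forall fun y => integral_congr_ae
      (Eventually.of_forall fun z => ?_))
    simp only
    rw [show x - t • b - √t • z - y = x - y - t • b - √t • z by abel]
    ring
  · have h := (integrable_heatWeight (N := N)).mul_prod (ρ.integrable_normed (μ := volume))
    have hc : Continuous (fun p : Euc N × Euc N => u (x - t • b - √t • p.1 - p.2)) :=
      hu.comp (by fun_prop)
    refine (h.mul_bdd hc.aestronglyMeasurable (Eventually.of_forall fun p => hM _)).congr
      (Eventually.of_forall fun p => ?_)
    simp only [Function.uncurry]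
    ring

theorem integrable_normed_mul {N : ℕ} (ρ : ContDiffBump (0 : Euc N)) {g : Euc N → ℝ}
    (hg : Continuous g) : Integrable (fun y => ρ.normed volume y * g y) :=
  (ρ.continuous_normed.mul hg).integrable_of_hasCompactSupport
    (ρ.hasCompactSupport_normed.mul_right)

theorem mollify_le_heatFlow {N : ℕ} (ρ : ContDiffBump (0 : Euc N)) {u : Euc N → ℝ}
    (hu : Continuous u) (huc : HasCompactSupport u) {b x₀ : Euc N} {K R : ℝ} (hρ : ρ.rOut < R)
    (hsub : IsLinSub u b K (ball x₀ R)) :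
    ∃ C : ℝ, ∃ t₀ > 0, ∀ t, 0 < t → t ≤ t₀ →
      mollify ρ u x₀ ≤ heatFlow (mollify ρ u) b x₀ t + K * t + C * t ^ 2 := by
  obtain ⟨M, hM⟩ := huc.exists_bound_of_continuous hu
  simp only [Real.norm_eq_abs] at hM
  obtain ⟨C, t₀, ht₀, h⟩ := IsLinSub.le_heatFlow M K (sub_pos.2 hρ) b
  refine ⟨C, t₀, ht₀, fun t ht htt => ?_⟩
  have hpt : ∀ y, ρ.normed volume y * u (x₀ - y) ≤
      ρ.normed volume y * (heatFlow u b (x₀ - y) t + (K * t + C * t ^ 2)) := by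
    intro y
    by_cases hy : y ∈ ball (0 : Euc N) ρ.rOut
    · refine mul_le_mul_of_nonneg_left ?_ (ρ.nonneg_normed y)
      rw [← add_assoc]
      refine h u hu huc hM (x₀ - y) (hsub.mono (ball_subset_ball' ?_)) t ht htt
      simp only [mem_ball, dist_zero_right] at hy
      simp only [dist_eq_norm, sub_sub_cancel_left, norm_neg]
      linarith
    · have : ρ.normed volume y = 0 := by
        rw [← ρ.support_normed_eq (μ := volume)] at hy
        simpa using hy
      simp [this]
  have hcf : Continuous fun y => heatFlow u b (x₀ - y) t :=
    (continuous_heatFlow hu hM b).comp (by fun_prop : Continuous fun y => (x₀ - y, t))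
  have h1 := integral_mono (integrable_normed_mul ρ (g := fun y => u (x₀ - y)) (by fun_prop))
    (integrable_normed_mul ρ (hcf.add continuous_const)) hpt
  have h2 : ∫ y, ρ.normed volume y * (heatFlow u b (x₀ - y) t + (K * t + C * t ^ 2)) =
      heatFlow (mollify ρ u) b x₀ t + (K * t + C * t ^ 2) := by
    generalize K * t + C * t ^ 2 = q
    simp only [mul_add]
    rw [integral_add (integrable_normed_mul ρ hcf) (ρ.integrable_normed.mul_const q),
      heatFlow_mollify ρ hu hM, integral_mul_const, ρ.integral_normed, one_mul]
  simp only [Pi.add_apply] at h1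
  rw [h2] at h1
  rw [mollify_apply]
  linarith

/-- Mollification preserves subsolutions of linear equations with constant coefficients. -/
theorem IsLinSub.mollify_le {N : ℕ} (ρ : ContDiffBump (0 : Euc N)) {u : Euc N → ℝ}
    (hu : Continuous u) (huc : HasCompactSupport u) {b x₀ : Euc N} {K R : ℝ} (hρ : ρ.rOut < R)
    (hsub : IsLinSub u b K (ball x₀ R)) :
    -lapl (mollify ρ u) x₀ + fderiv ℝ (mollify ρ u) x₀ b ≤ K := by
  obtain ⟨C, t₀, ht₀, h⟩ := mollify_le_heatFlow ρ hu huc hρ hsub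
  have hψ := contDiff_mollify ρ hu
  have hψc := hasCompactSupport_mollify ρ huc
  set ψ := mollify ρ u
  have hn : ContDiff ℝ 2 (-ψ) := hψ.neg
  have hnc : HasCompactSupport (-ψ) := hψc.neg
  obtain ⟨M, hM⟩ := hnc.exists_bound_of_continuous hn.continuous
  refine le_of_forall_pos_le_add fun η hη => ?_
  have hcont : Continuous fun x => -lapl (-ψ) x + fderiv ℝ (-ψ) x b :=
    hn.continuous_lapl.neg.add ((hn.continuous_fderiv two_ne_zero).clm_apply continuous_const)
  obtain ⟨r, hr, hball⟩ := Metric.mem_nhds_iff.1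
    (hcont.continuousAt.eventually_lt_const (lt_add_of_pos_right
      (-lapl (-ψ) x₀ + fderiv ℝ (-ψ) x₀ b) hη))
  obtain ⟨C', t₁, ht₁, h'⟩ := IsLinSub.le_heatFlow M (-lapl (-ψ) x₀ + fderiv ℝ (-ψ) x₀ b + η) hr b
  have h'' := h' (-ψ) hn.continuous hnc hM x₀ (hn.isLinSub fun x hx => (hball hx).le)
  rw [lapl_neg, fderiv_neg] at h''
  simp only [heatFlow_neg, Pi.neg_apply, _root_.neg_apply] at h''
  have hlim : Tendsto (fun t : ℝ => K + η + (C + C') * t) (𝓝[>] 0) (𝓝 (K + η + (C + C') * 0)) :=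
    (Continuous.tendsto (by fun_prop) 0).mono_left nhdsWithin_le_nhds
  rw [mul_zero, add_zero] at hlim
  refine ge_of_tendsto hlim ?_
  filter_upwards [Ioc_mem_nhdsGT (lt_min ht₀ ht₁)] with t ht
  have e1 := h t ht.1 (ht.2.trans (min_le_left _ _))
  have e2 := h'' t ht.1 (ht.2.trans (min_le_right _ _))
  refine le_of_mul_le_mul_right ?_ ht.1
  linarith

theorem young_rpow {m a b : ℝ} (hm : 1 < m) (ha : 0 ≤ a) (hb : 0 ≤ b) :
    m * b ^ (m - 1) * a ≤ a ^ m + (m - 1) * b ^ m := by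
  have h := Real.young_inequality_of_nonneg ha (Real.rpow_nonneg hb (m - 1))
    (Real.HolderConjugate.conjExponent hm)
  have h1 : m - 1 ≠ 0 := (sub_pos.2 hm).ne'
  have h0 : m ≠ 0 := by positivity
  rw [← Real.rpow_mul hb, Real.conjExponent, mul_div_cancel₀ _ h1] at h
  calc m * b ^ (m - 1) * a = m * (a * b ^ (m - 1)) := by ring
    _ ≤ m * (a ^ m / m + b ^ m / (m / (m - 1))) :=
      mul_le_mul_of_nonneg_left h (by positivity)
    _ = a ^ m + (m - 1) * b ^ m := by field_simp

/-- A viscosity subsolution of the Hamilton-Jacobi equation is a subsolution of each of its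
linearizations. -/
theorem IsIntSub.isLinSub {N : ℕ} {Ω : Set (Euc N)} (hΩ : IsOpen Ω) {m : ℝ} (hm : 2 < m)
    {h u v : Euc N → ℝ} (hsub : IsIntSub Ω h m u) (hv : ∀ x ∈ Ω, v x = u x) {S : Set (Euc N)}
    (hS : S ⊆ Ω) {K : ℝ} (hK : ∀ x ∈ S, h x ≤ K) (p : Euc N) :
    IsLinSub v ((m * ‖p‖ ^ (m - 2)) • p) (K + (m - 1) * ‖p‖ ^ m) S := by
  intro φ hφ x hx hmax
  have hev : u - φ =ᶠ[𝓝 x] v - φ := by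
    filter_upwards [hΩ.mem_nhds (hS hx)] with y hy
    simp [hv y hy]
  have hmax' : IsLocalMax (u - φ) x := hmax.congr hev.symm
  have h1 := hsub φ hφ x (hS hx) (hmax'.on Ω)
  simp only [statOp, zero_mul, add_zero] at h1
  have h2 : fderiv ℝ φ x ((m * ‖p‖ ^ (m - 2)) • p) =
      m * ‖p‖ ^ (m - 2) * inner ℝ (gradient φ x) p := by
    rw [map_smul, smul_eq_mul, inner_gradient_left]
  have h3 : ‖p‖ ^ (m - 2) * ‖p‖ = ‖p‖ ^ (m - 1) := by
    rw [← Real.rpow_add_one' (norm_nonneg p) (by linarith)]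
    ring_nf
  have h4 : m * ‖p‖ ^ (m - 2) * inner ℝ (gradient φ x) p ≤
      m * ‖p‖ ^ (m - 1) * ‖gradient φ x‖ := by
    calc m * ‖p‖ ^ (m - 2) * inner ℝ (gradient φ x) p
        ≤ m * ‖p‖ ^ (m - 2) * (‖gradient φ x‖ * ‖p‖) :=
          mul_le_mul_of_nonneg_left (real_inner_le_norm _ _) (by positivity)
      _ = m * ‖p‖ ^ (m - 1) * ‖gradient φ x‖ := by rw [← h3]; ring
  have h5 := young_rpow (m := m) (by linarith) (norm_nonneg (gradient φ x)) (norm_nonneg p)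
  have := hK x hx
  rw [h2]
  linarith

theorem IsIntSub.mollify_le {N : ℕ} {Ω : Set (Euc N)} (hΩ : IsOpen Ω) {m : ℝ} (hm : 2 < m)
    {h u v : Euc N → ℝ} (hsub : IsIntSub Ω h m u) (hv : ∀ x ∈ Ω, v x = u x)
    (hvc : Continuous v) (hvs : HasCompactSupport v) (ρ : ContDiffBump (0 : Euc N))
    {x₀ : Euc N} {R K : ℝ} (hρ : ρ.rOut < R) (hS : ball x₀ R ⊆ Ω)
    (hK : ∀ x ∈ ball x₀ R, h x ≤ K) :
    -lapl (mollify ρ v) x₀ + ‖gradient (mollify ρ v) x₀‖ ^ m ≤ K := by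
  set p := gradient (mollify ρ v) x₀ with hp
  have h1 := (hsub.isLinSub hΩ hm hv hS hK p).mollify_le ρ hvc hvs hρ
  have h2 : ‖p‖ ^ (m - 2) * ‖p‖ ^ 2 = ‖p‖ ^ m := by
    rw [← Real.rpow_natCast, ← Real.rpow_add' (norm_nonneg p) (by norm_num; linarith)]
    norm_num
  rw [map_smul, smul_eq_mul, ← inner_gradient_left, ← hp, real_inner_self_eq_norm_sq, mul_assoc,
    h2] at h1
  linarith

/-- Near a boundary point there is an inward direction along which `closure Ω` is translated
into `Ω`. -/
theorem HasC2Boundary.exists_add_smul_mem {N : ℕ} {Ω : Set (Euc N)} (hΩo : IsOpen Ω)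
    (hΩ2 : HasC2Boundary Ω) {z : Euc N} (hz : z ∈ closure Ω) :
    ∃ ν : Euc N, ∃ r > (0 : ℝ), r ≤ 1 ∧ ∃ δ₀ > (0 : ℝ), ∀ δ : ℝ, 0 < δ → δ ≤ δ₀ →
      ∀ x ∈ closure Ω ∩ closedBall z r, x + δ • ν ∈ Ω := by
  by_cases hzΩ : z ∈ Ω
  · obtain ⟨s, hs, hball⟩ := Metric.isOpen_iff.1 hΩo z hzΩ
    refine ⟨0, min 1 (s / 2), by positivity, min_le_left _ _, 1, one_pos, fun δ _ _ x hx => ?_⟩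
    rw [smul_zero, add_zero]
    refine hball (lt_of_le_of_lt (mem_closedBall.1 hx.2) ?_)
    exact (min_le_right _ _).trans_lt (half_lt_self hs)
  · obtain ⟨ρ, hρ, hΩ, hfr, hgrad⟩ := hΩ2
    have hzf : z ∈ frontier Ω := by rw [hΩo.frontier_eq]; exact ⟨hz, hzΩ⟩
    have hcl : ∀ x ∈ closure Ω, ρ x ≤ 0 := by
      refine closure_minimal (fun x hx => ?_) (isClosed_le hρ.continuous continuous_const)
      rw [hΩ] at hx
      exact le_of_lt (mem_ofPred.1 hx)
    set ν := -gradient ρ z with hν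
    have hcont : Continuous fun x => fderiv ℝ ρ x ν :=
      (hρ.continuous_fderiv two_ne_zero).clm_apply continuous_const
    have hneg : fderiv ℝ ρ z ν < 0 := by
      rw [← inner_gradient_left, hν, inner_neg_right, real_inner_self_eq_norm_sq, neg_lt_zero]
      have := norm_pos_iff.2 (hgrad z hzf)
      positivity
    obtain ⟨s, hs, hball⟩ := Metric.mem_nhds_iff.1
      (hcont.continuousAt.eventually_lt_const hneg)
    refine ⟨ν, min 1 (s / 2), by positivity, min_le_left _ _, s / (4 * (‖ν‖ + 1)), by positivity,
      fun δ hδ hδ0 x hx => ?_⟩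
    have hin : ∀ t ∈ Icc 0 δ, fderiv ℝ ρ (x + t • ν) ν < 0 := by
      intro t ht
      refine hball (mem_ball_iff_norm.2 ?_)
      have h1 : ‖x - z‖ ≤ s / 2 := (mem_closedBall_iff_norm.1 hx.2).trans (min_le_right _ _)
      have h2 : t * ‖ν‖ ≤ s / 4 := by
        have := ht.2.trans hδ0
        rw [le_div_iff₀ (by positivity)] at this
        linarith [ht.1]
      calc ‖x + t • ν - z‖ = ‖(x - z) + t • ν‖ := by rw [add_sub_right_comm]
        _ ≤ ‖x - z‖ + ‖t • ν‖ := norm_add_le _ _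
        _ = ‖x - z‖ + t * ‖ν‖ := by rw [norm_smul, Real.norm_of_nonneg ht.1]
        _ < s := by linarith
    have hanti : StrictAntiOn (fun t : ℝ => ρ (x + t • ν)) (Icc 0 δ) := by
      refine strictAntiOn_of_deriv_neg (convex_Icc 0 δ)
        (hρ.continuous.comp (by fun_prop)).continuousOn fun t ht => ?_
      rw [(hasDerivAt_line hρ x ν t).deriv]
      exact hin t (interior_subset ht)
    have := hanti (left_mem_Icc.2 hδ.le) (right_mem_Icc.2 hδ.le) hδ
    simp only [zero_smul, add_zero] at this
    rw [hΩ]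
    exact this.trans_le (hcl x hx.1)

theorem HasC2Boundary.exists_ball_subset {N : ℕ} {Ω : Set (Euc N)} (hΩo : IsOpen Ω)
    (hΩ2 : HasC2Boundary Ω) {z : Euc N} (hz : z ∈ closure Ω) :
    ∃ ν : Euc N, ∃ r > (0 : ℝ), r ≤ 1 ∧ ∃ δ₀ > (0 : ℝ), ∀ δ : ℝ, 0 < δ → δ ≤ δ₀ → ∃ ε > (0 : ℝ),
      ∀ x ∈ closure Ω ∩ closedBall z r, ball (x + δ • ν) ε ⊆ Ω := by
  obtain ⟨ν, r, hr, hr1, δ₀, hδ₀, h⟩ := hΩ2.exists_add_smul_mem hΩo hz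
  refine ⟨ν, r, hr, hr1, δ₀, hδ₀, fun δ hδ hδ0 => ?_⟩
  have hcomp : IsCompact ((fun x => x + δ • ν) '' (closure Ω ∩ closedBall z r)) :=
    ((isCompact_closedBall z r).inter_left isClosed_closure).image (by fun_prop)
  have himg : (fun x => x + δ • ν) '' (closure Ω ∩ closedBall z r) ⊆ Ω := by
    rintro _ ⟨x, hx, rfl⟩
    exact h δ hδ hδ0 x hx
  obtain ⟨ε, hε, hsub⟩ := hcomp.exists_thickening_subset_open hΩo himg
  refine ⟨ε, hε, fun x hx => ?_⟩
  have hx' : x + δ • ν ∈ (fun x => x + δ • ν) '' (closure Ω ∩ closedBall z r) :=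
    mem_image_of_mem (fun x => x + δ • ν) hx
  exact (ball_subset_thickening hx' ε).trans hsub

theorem norm_gradient {N : ℕ} (φ : Euc N → ℝ) (x : Euc N) : ‖gradient φ x‖ = ‖fderiv ℝ φ x‖ :=
  LinearIsometryEquiv.norm_map _ _

theorem lapl_norm_sq {N : ℕ} (x : Euc N) : lapl (fun y : Euc N => ‖y‖ ^ 2) x = 2 * N := by
  rw [lapl_eq_sum_of_lines (contDiff_norm_sq ℝ) x
    (fun i s => hasDerivAt_norm_sq_line x (EuclideanSpace.single i 1) s) (c := fun _ => 2)]
  · simp [mul_comm]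
  · intro i
    have h := ((hasDerivAt_add_smul x (EuclideanSpace.single i (1 : ℝ)) 0).inner ℝ
      (hasDerivAt_const (0 : ℝ) (EuclideanSpace.single i (1 : ℝ)))).const_mul 2
    refine h.congr_deriv ?_
    simp

theorem norm_fderiv_norm_sq {N : ℕ} (x : Euc N) :
    ‖fderiv ℝ (fun y : Euc N => ‖y‖ ^ 2) x‖ = 2 * ‖x‖ := by
  rw [fderiv_norm_sq_apply, ← Nat.cast_smul_eq_nsmul ℝ, norm_smul, innerSL_apply_norm]
  simp

/-- A continuous function on a bounded closed set extends to a compactly supported one. -/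
theorem exists_hasCompactSupport_extension {N : ℕ} {S : Set (Euc N)} (hS : IsClosed S)
    (hSb : Bornology.IsBounded S) {u : Euc N → ℝ} (hu : ContinuousOn u S) :
    ∃ v : Euc N → ℝ, Continuous v ∧ HasCompactSupport v ∧ ∀ x ∈ S, v x = u x := by
  obtain ⟨g, hg⟩ := ContinuousMap.exists_restrict_eq hS ⟨S.domRestrict u, hu.domRestrict⟩
  obtain ⟨R, hR, hRs⟩ := hSb.subset_closedBall_lt 0 (0 : Euc N)
  let χ : ContDiffBump (0 : Euc N) := ⟨R, R + 1, hR, by linarith⟩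
  refine ⟨fun x => χ x * g x, χ.continuous.mul g.continuous, χ.hasCompactSupport.mul_right,
    fun x hx => ?_⟩
  have h1 : g x = u x := congrArg (fun k : C(S, ℝ) => k ⟨x, hx⟩) hg
  simp only [χ.one_of_mem_closedBall (hRs hx), one_mul, h1]

/-- The test function obtained from a translated mollification by a quadratic perturbation
satisfies a perturbed inequality. -/
theorem lapl_gradient_perturbation {N : ℕ} {ψ : Euc N → ℝ} (hψ : ContDiff ℝ 2 ψ) {m θ : ℝ}
    (hm : 1 ≤ m) (hθ : 0 ≤ θ) (hθ1 : θ ≤ 1) (v z x : Euc N) (hx : ‖x - z‖ ≤ 1) :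
    -lapl (((1 - θ) • fun y => ψ (y + v)) + (-θ) • fun y => ‖y + -z‖ ^ 2) x +
        ‖gradient (((1 - θ) • fun y => ψ (y + v)) + (-θ) • fun y => ‖y + -z‖ ^ 2) x‖ ^ m ≤
      (1 - θ) * (-lapl ψ (x + v) + ‖gradient ψ (x + v)‖ ^ m) + θ * (2 * N + 2 ^ m) := by
  have h1 : ContDiff ℝ 2 (fun y => ψ (y + v)) := hψ.comp (by fun_prop)
  have h2 : ContDiff ℝ 2 (fun y : Euc N => ‖y + -z‖ ^ 2) :=
    (contDiff_norm_sq ℝ).comp (by fun_prop)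
  have h1' : ContDiff ℝ 2 ((1 - θ) • fun y => ψ (y + v)) := contDiff_const.smul h1
  have h2' : ContDiff ℝ 2 ((-θ) • fun y : Euc N => ‖y + -z‖ ^ 2) := contDiff_const.smul h2
  have hd1 := (h1.differentiable two_ne_zero).differentiableAt (x := x)
  have hd2 := (h2.differentiable two_ne_zero).differentiableAt (x := x)
  have hN : ‖fderiv ℝ (((1 - θ) • fun y => ψ (y + v)) + (-θ) • fun y => ‖y + -z‖ ^ 2) x‖ ≤
      (1 - θ) * ‖fderiv ℝ ψ (x + v)‖ + θ * 2 := by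
    rw [fderiv_add (hd1.const_smul _) (hd2.const_smul _), fderiv_const_smul hd1,
      fderiv_const_smul hd2, fderiv_comp_add_right,
      fderiv_comp_add_right (f := fun y : Euc N => ‖y‖ ^ 2)]
    refine (norm_add_le _ _).trans ?_
    rw [norm_smul, norm_smul, norm_fderiv_norm_sq, norm_neg, Real.norm_of_nonneg hθ,
      Real.norm_of_nonneg (sub_nonneg.2 hθ1), ← sub_eq_add_neg]
    have := mul_le_mul_of_nonneg_left hx hθ
    linarith
  have hconv : ((1 - θ) * ‖fderiv ℝ ψ (x + v)‖ + θ * 2) ^ m ≤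
      (1 - θ) * ‖fderiv ℝ ψ (x + v)‖ ^ m + θ * 2 ^ m := by
    have := (convexOn_rpow hm).2 (x := ‖fderiv ℝ ψ (x + v)‖) (norm_nonneg _) (y := 2)
      (by norm_num) (sub_nonneg.2 hθ1) hθ (by ring)
    simpa using this
  have hpow := (Real.rpow_le_rpow (norm_nonneg _) hN (by linarith)).trans hconv
  rw [lapl_add h1' h2', lapl_const_smul h1, lapl_const_smul h2, lapl_comp_add_right,
    lapl_comp_add_right (fun y => ‖y‖ ^ 2), lapl_norm_sq, norm_gradient, norm_gradient]
  linarith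

/-- Translated mollifications of a compactly supported function approximate it uniformly. -/
theorem abs_mollify_sub_le {N : ℕ} {u : Euc N → ℝ} (hu : Continuous u) {κ σ : ℝ}
    (h : ∀ x y, dist x y < κ → dist (u x) (u y) ≤ σ / 2) (ρ : ContDiffBump (0 : Euc N))
    (hρ : ρ.rOut ≤ κ) {v : Euc N} (hv : ‖v‖ < κ) (x : Euc N) :
    |mollify ρ u (x + v) - u x| ≤ σ := by
  have h1 : dist (mollify ρ u (x + v)) (u (x + v)) ≤ σ / 2 :=
    ρ.dist_normed_convolution_le hu.aestronglyMeasurable fun y hy =>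
      h y _ ((mem_ball.1 hy).trans_le hρ)
  have h2 : dist (u (x + v)) (u x) ≤ σ / 2 := h _ _ (by simpa [dist_eq_norm] using hv)
  rw [← Real.dist_eq]
  linarith [dist_triangle (mollify ρ u (x + v)) (u (x + v)) (u x)]

/-- Comparison: the constant of an interior subsolution is at least that of a state-constraint
solution. -/
theorem IsSCSolution.le_of_isIntSub {N : ℕ} {Ω : Set (Euc N)} (hΩo : IsOpen Ω)
    (hΩb : Bornology.IsBounded Ω) (hΩn : Ω.Nonempty) (hΩ2 : HasC2Boundary Ω) {m : ℝ} (hm : 2 < m)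
    {f : Euc N → ℝ} (hf : ContinuousOn f (closure Ω)) {a c : ℝ} {u w : Euc N → ℝ}
    (hw : IsSCSolution Ω (fun x => f x + c) 0 m w) (hu : ContinuousOn u (closure Ω))
    (hsub : IsIntSub Ω (fun x => f x + a) m u) : c ≤ a := by
  by_contra! hac
  have hcomp : IsCompact (closure Ω) := hΩb.isCompact_closure
  obtain ⟨F, hF⟩ := hcomp.exists_bound_of_continuousOn hf
  obtain ⟨v, hvc, hvs, hvu⟩ := exists_hasCompactSupport_extension isClosed_closure
    hΩb.closure hu
  set G : ℝ := |F| + |a| + (2 * N + 2 ^ m) + 1 with hG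
  have h2m : (0 : ℝ) < 2 ^ m := by positivity
  have hGpos : 0 < G := by positivity
  set θ : ℝ := min (1 / 2) ((c - a) / (4 * G)) with hθdef
  have hca : 0 < c - a := sub_pos.2 hac
  have hθ : 0 < θ := by positivity
  have hθ1 : θ ≤ 1 := (min_le_left _ _).trans (by norm_num)
  have hθG : θ * G ≤ (c - a) / 4 := by
    have : θ ≤ (c - a) / (4 * G) := min_le_right _ _
    rw [le_div_iff₀ (by positivity)] at this
    linarith
  obtain ⟨z, hz, hzmin⟩ := hcomp.exists_isMinOn hΩn.closure
    (hw.1.sub (hvc.continuousOn.const_smul (1 - θ)))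
  obtain ⟨ν, r, hr, hr1, δ₀, hδ₀, hgeom⟩ := hΩ2.exists_ball_subset hΩo hz
  set σ : ℝ := θ * r ^ 2 / 4 with hσ
  have hσpos : 0 < σ := by positivity
  obtain ⟨κ₁, hκ₁, hvuc⟩ := Metric.uniformContinuous_iff.1
    (hvs.uniformContinuous_of_continuous hvc) (σ / 2) (by positivity)
  obtain ⟨κ₂, hκ₂, hfuc⟩ := Metric.uniformContinuousOn_iff.1
    (hcomp.uniformContinuousOn_of_continuous hf) ((c - a) / 4) (by positivity)
  set κ : ℝ := min κ₁ κ₂ with hκdef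
  have hκ : 0 < κ := lt_min hκ₁ hκ₂
  set δ : ℝ := min δ₀ (κ / (2 * (‖ν‖ + 1))) with hδdef
  have hδ : 0 < δ := by positivity
  have hδν : ‖δ • ν‖ < κ / 2 := by
    have : δ ≤ κ / (2 * (‖ν‖ + 1)) := min_le_right _ _
    rw [le_div_iff₀ (by positivity)] at this
    rw [norm_smul, Real.norm_of_nonneg hδ.le]
    linarith
  obtain ⟨ε, hε, hball⟩ := hgeom δ hδ (min_le_left _ _)
  set R : ℝ := min ε (κ / 2) with hR
  have hRpos : 0 < R := by positivity
  let ρ : ContDiffBump (0 : Euc N) := ⟨R / 4, R / 2, by positivity, by linarith⟩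
  have hρR : ρ.rOut < R := half_lt_self hRpos
  set ψ := mollify ρ v with hψdef
  have hψ : ContDiff ℝ 2 ψ := contDiff_mollify ρ hvc
  have happrox : ∀ x, |ψ (x + δ • ν) - v x| ≤ σ := by
    refine abs_mollify_sub_le hvc (κ := κ₁) (fun x y hxy => (hvuc hxy).le) ρ ?_ ?_
    · exact hρR.le.trans ((min_le_right _ _).trans (by linarith [min_le_left κ₁ κ₂]))
    · linarith [min_le_left κ₁ κ₂]
  let φ : Euc N → ℝ := ((1 - θ) • fun y => ψ (y + δ • ν)) + (-θ) • fun y => ‖y + -z‖ ^ 2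
  have hφval : ∀ x, φ x = (1 - θ) * ψ (x + δ • ν) - θ * ‖x - z‖ ^ 2 := by
    intro x
    simp only [φ, Pi.add_apply, Pi.smul_apply, smul_eq_mul, ← sub_eq_add_neg]
    ring
  have hφ : ContDiff ℝ 2 φ :=
    (contDiff_const.smul (hψ.comp (by fun_prop))).add
      (contDiff_const.smul ((contDiff_norm_sq ℝ).comp (by fun_prop)))
  have hKc : IsCompact (closure Ω ∩ closedBall z r) :=
    (isCompact_closedBall z r).inter_left isClosed_closure
  have hzK : z ∈ closure Ω ∩ closedBall z r := ⟨hz, mem_closedBall_self hr.le⟩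
  obtain ⟨x, ⟨hxΩ, hxr⟩, hxmin⟩ := hKc.exists_isMinOn ⟨z, hzK⟩
    ((hw.1.mono inter_subset_left).sub hφ.continuous.continuousOn)
  have hxnorm : ‖x - z‖ ≤ r := mem_closedBall_iff_norm.1 hxr
  have hxball : x ∈ ball z r := by
    refine mem_ball_iff_norm.2 (lt_of_le_of_ne hxnorm fun hxr' => ?_)
    have e1 : w x - φ x ≤ w z - φ z := hxmin hzK
    have e2 : w z - (1 - θ) * v z ≤ w x - (1 - θ) * v x := hzmin hxΩ
    rw [hφval, hφval, hxr', sub_self, norm_zero] at e1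
    have e3 := mul_le_mul_of_nonneg_left (abs_le.1 (happrox x)).2 (sub_nonneg.2 hθ1)
    have e4 := mul_le_mul_of_nonneg_left (abs_le.1 (happrox z)).1 (sub_nonneg.2 hθ1)
    have e5 : 0 < θ * σ := by positivity
    have e6 : θ * r ^ 2 = 4 * σ := by rw [hσ]; ring
    linarith
  have hloc : IsLocalMinOn (w - φ) (closure Ω) x := by
    filter_upwards [mem_nhdsWithin_of_mem_nhds (isOpen_ball.mem_nhds hxball),
      self_mem_nhdsWithin] with y hy hyΩ
    exact hxmin ⟨hyΩ, ball_subset_closedBall hy⟩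
  have hsuper := hw.2.2 φ hφ x hxΩ hloc
  simp only [statOp, zero_mul, add_zero] at hsuper
  have hballR : ball (x + δ • ν) R ⊆ Ω :=
    (ball_subset_ball (min_le_left _ _)).trans (hball x ⟨hxΩ, hxr⟩)
  have hmoll := hsub.mollify_le hΩo hm (fun y hy => hvu y (subset_closure hy)) hvc hvs ρ hρR
    hballR (K := f x + (c - a) / 4 + a) (fun y hy => by
      have hd : dist y x < κ₂ := by
        have h1 := dist_triangle y (x + δ • ν) x
        have h2 : dist (x + δ • ν) x = ‖δ • ν‖ := by simp [dist_eq_norm]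
        have h3 := (mem_ball.1 hy).trans_le (min_le_right ε (κ / 2))
        linarith [min_le_right κ₁ κ₂]
      have := hfuc y (subset_closure (hballR hy)) x hxΩ hd
      rw [Real.dist_eq] at this
      linarith [le_abs_self (f y - f x)])
  have hpert := lapl_gradient_perturbation hψ (m := m) (by linarith) hθ.le hθ1 (δ • ν) z x
    (hxnorm.trans hr1)
  have hmul := mul_le_mul_of_nonneg_left hmoll (sub_nonneg.2 hθ1)
  have hfx : -|F| ≤ f x := (abs_le.1 ((hF x hxΩ).trans (le_abs_self F))).1
  have hfin : θ * (-f x - (c - a) / 4 - a + (2 * N + 2 ^ m)) ≤ θ * G :=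
    mul_le_mul_of_nonneg_left (by rw [hG]; linarith [neg_abs_le a]) hθ.le
  linarith

/-- Characterization of the ergodic constant,
Proposition 3.11 of the paper. -/
theorem stmt14 {N : ℕ} (hN : 1 ≤ N) (Ω : Set (Euc N))
    (hΩo : IsOpen Ω) (hΩb : Bornology.IsBounded Ω) (hΩc : IsConnected Ω)
    (hΩ2 : HasC2Boundary Ω)
    (m : ℝ) (hm : 2 < m) (f : Euc N → ℝ) (hf : ContinuousOn f (closure Ω))
    (c : ℝ)
    (hc : ∃ uInf : Euc N → ℝ,
      HolderOnCl ((m - 2) / (m - 1)) (closure Ω) uInf ∧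
      LocLipIn Ω uInf ∧
      IsSCSolution Ω (fun x => f x + c) 0 m uInf) :
    c = sInf {a : ℝ | ∃ ua : Euc N → ℝ, ContinuousOn ua (closure Ω) ∧
      IsIntSub Ω (fun x => f x + a) m ua} := by
  obtain ⟨w, _, _, hw⟩ := hc
  symm
  refine IsLeast.csInf_eq ⟨⟨w, hw.1, hw.2.1⟩, ?_⟩
  rintro a ⟨u, hu, hsub⟩
  exact hw.le_of_isIntSub hΩo hΩb hΩc.nonempty hΩ2 hm hf hu hsub
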